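/- Let θ₁ = p₁π/q₁ with gcd(p₁,q₁)=1, θ₁ ≠ π/2, and let θ₂,...,θ_n ∈ (0,π) be such that {π, θ₂,...,θ_n} is rationally independent. Then for any nonzero vectors f₁,...,f_n ∈ ℝ² not lying on the coordinate axes and any sufficiently small ε > 0, there exists t ∈ ℕ such that each R(tθ_i)f_i lies outside the ε-cones around the coordinate axes, and all the vectors R(tθ₁)f₁,...,R(tθ_n)f_n lie in the same open quadrant or in quadrants that are pairwise equal or diametrically opposite. -/

import Mathlib

open Real

/-- `z` and `w` lie in the same open quadrant of `ℝ² ≃ ℂ` or in diametrically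
opposite ones. -/
def SameOrOppositeQuadrant (z w : ℂ) : Prop :=
  (0 < z.re * w.re ∧ 0 < z.im * w.im) ∨ (z.re * w.re < 0 ∧ z.im * w.im < 0)

open Filter Topology UnitAddTorus in
/-- Birkhoff average along the orbit of the translation by `a`. -/
noncomputable def avgK {d : Type*} [Fintype d] (a : UnitAddTorus d) (N : ℕ)
    (f : C(UnitAddTorus d, ℂ)) (x : UnitAddTorus d) : ℂ :=
  ((N : ℂ) + 1)⁻¹ * ∑ k ∈ Finset.range (N + 1), f (x + k • a)

lemma mFourier_add_arg {d : Type*} [Fintype d] (m : d → ℤ) (x y : UnitAddTorus d) :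
    UnitAddTorus.mFourier m (x + y)
      = UnitAddTorus.mFourier m x * UnitAddTorus.mFourier m y := by
  simp only [UnitAddTorus.mFourier, ContinuousMap.coe_mk, ← Finset.prod_mul_distrib]
  refine Finset.prod_congr rfl fun i _ => ?_
  simp [fourier_apply, AddCircle.toCircle_add]

lemma mFourier_nsmul_arg {d : Type*} [Fintype d] (m : d → ℤ) (x : UnitAddTorus d) (k : ℕ) :
    UnitAddTorus.mFourier m (k • x) = (UnitAddTorus.mFourier m x) ^ k := by
  induction k with
  | zero => simp [UnitAddTorus.mFourier]
  | succ k ih => rw [succ_nsmul, mFourier_add_arg, ih, pow_succ]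

lemma mFourier_norm_arg {d : Type*} [Fintype d] (m : d → ℤ) (x : UnitAddTorus d) :
    ‖UnitAddTorus.mFourier m x‖ = 1 := by
  simp only [UnitAddTorus.mFourier, ContinuousMap.coe_mk, norm_prod, fourier_apply,
    Circle.norm_coe, Finset.prod_const_one]

lemma avgK_norm {d : Type*} [Fintype d] (a : UnitAddTorus d) (N : ℕ)
    (f : C(UnitAddTorus d, ℂ)) (x : UnitAddTorus d) : ‖avgK a N f x‖ ≤ ‖f‖ := by
  unfold avgK
  have h1 : ‖∑ k ∈ Finset.range (N + 1), f (x + k • a)‖ ≤ (N + 1) * ‖f‖ := by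
    refine (norm_sum_le_of_le _ (fun k _ => f.norm_coe_le_norm _)).trans ?_
    simp
  have h2 : ‖((N : ℂ) + 1)⁻¹‖ = ((N : ℝ) + 1)⁻¹ := by
    rw [norm_inv]
    congr 1
    have := Complex.norm_natCast (N + 1)
    push_cast at this
    exact this
  rw [norm_mul, h2]
  have h3 : (0 : ℝ) < N + 1 := by positivity
  rw [inv_mul_le_iff₀ h3]
  exact h1

lemma avgK_sub {d : Type*} [Fintype d] (a : UnitAddTorus d) (N : ℕ)
    (f g : C(UnitAddTorus d, ℂ)) (x : UnitAddTorus d) :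
    avgK a N (f - g) x = avgK a N f x - avgK a N g x := by
  simp [avgK, Finset.sum_sub_distrib, mul_sub]

open Filter Topology in
lemma avgK_mFourier {d : Type*} [Fintype d] (a : UnitAddTorus d)
    (ha : ∀ m : d → ℤ, m ≠ 0 → UnitAddTorus.mFourier m a ≠ 1) (m : d → ℤ)
    (x : UnitAddTorus d) :
    Tendsto (fun N : ℕ => avgK a N (UnitAddTorus.mFourier m) x
      - avgK a N (UnitAddTorus.mFourier m) 0) atTop (𝓝 0) := by
  by_cases hm : m = 0
  · subst hm
    simp [UnitAddTorus.mFourier_zero, avgK]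
  have hw := ha m hm
  set w := UnitAddTorus.mFourier m a with hwdef
  have hwn : ‖w‖ = 1 := mFourier_norm_arg m a
  have key : ∀ y, Tendsto (fun N : ℕ => avgK a N (UnitAddTorus.mFourier m) y) atTop (𝓝 0) := by
    intro y
    have hb : Tendsto (fun N : ℕ => (1 / ((N : ℝ) + 1)) * (2 / ‖w - 1‖)) atTop (𝓝 0) := by
      simpa using tendsto_one_div_add_atTop_nhds_zero_nat.mul_const (2 / ‖w - 1‖)
    refine squeeze_zero_norm (fun N => ?_) hb
    unfold avgK
    have h1 : ∑ k ∈ Finset.range (N + 1), UnitAddTorus.mFourier m (y + k • a)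
        = UnitAddTorus.mFourier m y * ((w ^ (N + 1) - 1) / (w - 1)) := by
      rw [← geom_sum_eq hw, Finset.mul_sum]
      refine Finset.sum_congr rfl fun k _ => ?_
      rw [mFourier_add_arg, mFourier_nsmul_arg]
    have h2 : ‖((N : ℂ) + 1)⁻¹‖ = 1 / ((N : ℝ) + 1) := by
      rw [norm_inv, one_div]
      congr 1
      have := Complex.norm_natCast (N + 1)
      push_cast at this
      exact this
    rw [h1, norm_mul, norm_mul, h2, mFourier_norm_arg, one_mul, norm_div]
    gcongr
    refine (norm_sub_le _ _).trans ?_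
    rw [norm_pow, hwn]
    norm_num
  simpa using (key x).sub (key 0)

open Filter Topology in
lemma avgK_tendsto {d : Type*} [Fintype d] (a : UnitAddTorus d)
    (ha : ∀ m : d → ℤ, m ≠ 0 → UnitAddTorus.mFourier m a ≠ 1) (f : C(UnitAddTorus d, ℂ))
    (x : UnitAddTorus d) :
    Tendsto (fun N : ℕ => avgK a N f x - avgK a N f 0) atTop (𝓝 0) := by
  have hspan : ∀ p ∈ Submodule.span ℂ (Set.range (UnitAddTorus.mFourier (d := d))),
      Tendsto (fun N : ℕ => avgK a N p x - avgK a N p 0) atTop (𝓝 0) := by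
    intro p hp
    induction hp using Submodule.span_induction with
    | mem p hp =>
      obtain ⟨m, rfl⟩ := hp
      exact avgK_mFourier a ha m x
    | zero => simp [avgK]
    | add p q _ _ hp hq =>
      have := hp.add hq
      rw [add_zero] at this
      refine this.congr fun N => ?_
      simp only [avgK, ContinuousMap.add_apply, Finset.sum_add_distrib]
      ring
    | smul c p _ hp =>
      have := hp.const_mul c
      rw [mul_zero] at this
      refine this.congr fun N => ?_
      simp only [avgK, ContinuousMap.smul_apply, smul_eq_mul, ← Finset.mul_sum]
      ring
  have hf : f ∈ closure (Submodule.span ℂ (Set.range (UnitAddTorus.mFourier (d := d))) :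
      Set C(UnitAddTorus d, ℂ)) := by
    rw [← Submodule.topologicalClosure_coe, UnitAddTorus.span_mFourier_closure_eq_top]
    trivial
  rw [Metric.tendsto_atTop]
  intro ε hε
  obtain ⟨p, hp, hfp⟩ := Metric.mem_closure_iff.1 hf (ε / 4) (by positivity)
  obtain ⟨N₀, hN₀⟩ := Metric.tendsto_atTop.1 (hspan p hp) (ε / 2) (by positivity)
  refine ⟨N₀, fun N hN => ?_⟩
  have h1 := hN₀ N hN
  rw [dist_zero_right] at h1 ⊢
  rw [dist_eq_norm] at hfp
  have h2 := avgK_norm a N (f - p) x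
  have h3 := avgK_norm a N (f - p) 0
  rw [avgK_sub] at h2 h3
  have : avgK a N f x - avgK a N f 0 = (avgK a N f x - avgK a N p x)
      - (avgK a N f 0 - avgK a N p 0) + (avgK a N p x - avgK a N p 0) := by ring
  rw [this]
  have h4 := norm_add_le ((avgK a N f x - avgK a N p x)
      - (avgK a N f 0 - avgK a N p 0)) (avgK a N p x - avgK a N p 0)
  have h5 := norm_sub_le (avgK a N f x - avgK a N p x) (avgK a N f 0 - avgK a N p 0)
  linarith

open Filter Topology in
/-- Kronecker's theorem: the forward orbit of `a` is dense in the torus. -/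
lemma kronecker_torus {d : Type*} [Fintype d] (a : UnitAddTorus d)
    (ha : ∀ m : d → ℤ, m ≠ 0 → UnitAddTorus.mFourier m a ≠ 1)
    (U : Set (UnitAddTorus d)) (hU : IsOpen U) (hne : U.Nonempty) : ∃ k : ℕ, k • a ∈ U := by
  by_contra! hcon
  have hcne : (Uᶜ).Nonempty := ⟨_, hcon 0⟩
  let φ : UnitAddTorus d → ℝ := fun x => Metric.infDist x Uᶜ
  have hφc : Continuous φ := Metric.continuous_infDist_pt _
  have hφ0 : ∀ x, 0 ≤ φ x := fun x => Metric.infDist_nonneg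
  have hφpos : ∀ x ∈ U, 0 < φ x := by
    intro x hx
    refine ((hU.isClosed_compl.notMem_iff_infDist_pos hcne).1 ?_)
    simpa using hx
  have hφz : ∀ x, x ∉ U → φ x = 0 := fun x hx => Metric.infDist_zero_of_mem hx
  let f : C(UnitAddTorus d, ℂ) := ⟨fun x => (φ x : ℂ), by fun_prop⟩
  have h0 : ∀ N, avgK a N f 0 = 0 := by
    intro N
    unfold avgK
    rw [Finset.sum_eq_zero, mul_zero]
    intro k _
    simp only [f, ContinuousMap.coe_mk, zero_add]
    rw [hφz _ (hcon k)]
    simp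
  have hlim : ∀ y, Tendsto (fun N : ℕ => avgK a N f y) atTop (𝓝 0) := by
    intro y
    simpa [h0] using avgK_tendsto a ha f y
  obtain ⟨u, hu⟩ := hne
  obtain ⟨F, hF⟩ := isCompact_univ.elim_finite_subcover
    (fun y : UnitAddTorus d => {x | y + x ∈ U})
    (fun y => hU.preimage (continuous_const.add continuous_id))
    (fun x _ => Set.mem_iUnion.2 ⟨u - x, by simpa using hu⟩)
  let g : UnitAddTorus d → ℝ := fun x => ∑ y ∈ F, φ (y + x)
  have hgc : Continuous g := by
    refine continuous_finsetSum _ fun y _ => hφc.comp (by fun_prop)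
  have hgpos : ∀ x, 0 < g x := by
    intro x
    have hx := hF (Set.mem_univ x)
    simp only [Set.mem_iUnion] at hx
    obtain ⟨y, hy, hyx⟩ := hx
    exact Finset.sum_pos' (fun y _ => hφ0 _) ⟨y, hy, hφpos _ hyx⟩
  obtain ⟨x₀, -, hx₀⟩ := isCompact_univ.exists_isMinOn ⟨u, Set.mem_univ u⟩ hgc.continuousOn
  have hmin : ∀ x, g x₀ ≤ g x := fun x => hx₀ (Set.mem_univ x)
  have hs : Tendsto (fun N : ℕ => ∑ y ∈ F, avgK a N f y) atTop (𝓝 0) := by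
    simpa using tendsto_finsetSum F (fun y _ => hlim y)
  have hre : Tendsto (fun N : ℕ => (∑ y ∈ F, avgK a N f y).re) atTop (𝓝 0) := by
    have h := (Complex.continuous_re.tendsto 0).comp hs
    rw [Complex.zero_re] at h
    exact h
  have hge : ∀ N : ℕ, g x₀ ≤ (∑ y ∈ F, avgK a N f y).re := by
    intro N
    have e : ∑ y ∈ F, avgK a N f y
        = ((((N : ℝ) + 1)⁻¹ * ∑ k ∈ Finset.range (N + 1), g (k • a) : ℝ) : ℂ) := by
      simp only [avgK, g, f, ContinuousMap.coe_mk]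
      rw [← Finset.mul_sum, Finset.sum_comm]
      push_cast
      rfl
    rw [e, Complex.ofReal_re]
    have h3 : (0 : ℝ) < N + 1 := by positivity
    rw [le_inv_mul_iff₀ h3]
    have := Finset.card_nsmul_le_sum (Finset.range (N + 1)) (fun k => g (k • a)) (g x₀)
      (fun k _ => hmin _)
    simpa using this
  have := ge_of_tendsto' hre hge
  linarith [hgpos x₀]

lemma exists_cone_gap (z : ℂ) (hz : z.re ≠ 0 ∧ z.im ≠ 0) :
    ∃ δ > 0, ∀ u ∈ ({1, -1, Complex.I, -Complex.I} : Set ℂ), δ ≤ |Complex.arg (z / u)| := by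
  have h : ∀ w : ℂ, w.im ≠ 0 → 0 < |Complex.arg w| := by
    intro w hw
    rw [abs_pos]
    intro h0
    exact hw (Complex.arg_eq_zero_iff.1 h0).2
  have h1 := h (z / 1) (by simpa using hz.2)
  have h2 := h (z / -1) (by simpa [div_neg] using hz.2)
  have h3 := h (z / Complex.I) (by simpa using hz.1)
  have h4 := h (z / -Complex.I) (by simpa [div_neg] using hz.1)
  refine ⟨min (min |Complex.arg (z / 1)| |Complex.arg (z / -1)|)
    (min |Complex.arg (z / Complex.I)| |Complex.arg (z / -Complex.I)|),
    lt_min (lt_min h1 h2) (lt_min h3 h4), ?_⟩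
  intro u hu
  simp only [Set.mem_insert_iff, Set.mem_singleton_iff] at hu
  rcases hu with rfl | rfl | rfl | rfl
  · exact (min_le_left _ _).trans (min_le_left _ _)
  · exact (min_le_left _ _).trans (min_le_right _ _)
  · exact (min_le_right _ _).trans (min_le_left _ _)
  · exact (min_le_right _ _).trans (min_le_right _ _)

lemma exists_pos_lower {n : ℕ} (g : Fin n → ℝ) (hg : ∀ i, 0 < g i) :
    ∃ δ > 0, ∀ i, δ ≤ g i := by
  rcases isEmpty_or_nonempty (Fin n) with h | h
  · exact ⟨1, one_pos, fun i => h.elim i⟩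
  · obtain ⟨i, hi⟩ := Finite.exists_min g
    exact ⟨g i, hg i, hi⟩

lemma pos_trans {a b c : ℝ} (h1 : 0 < a * c) (h2 : 0 < b * c) : 0 < a * b := by
  have h3 : 0 < (a * b) * (c * c) := by nlinarith [mul_pos h1 h2]
  exact pos_of_mul_pos_left h3 (mul_self_nonneg c)

/-- Lemma 4.1: one exceptional quasi-momentum `θ₁ = p₁π/q₁ ≠ π/2` together with
angles `θ₂, …, θ_n` rationally independent with `π`: all the vectors can be
simultaneously rotated outside the `ε`-cones around the coordinate axes into
pairwise equal or diametrically opposite open quadrants. -/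
theorem stmt15 (p₁ q₁ : ℕ) (hp : 0 < p₁) (hq : 0 < q₁) (hcop : Nat.Coprime p₁ q₁)
    (θ₁ : ℝ) (hθ₁ : θ₁ = p₁ * π / q₁) (hθhalf : θ₁ ≠ π / 2)
    (n : ℕ) (θ : Fin n → ℝ) (hθ : ∀ i, θ i ∈ Set.Ioo 0 π)
    (hind : ∀ (c₀ : ℚ) (c : Fin n → ℚ),
      (c₀ : ℝ) * π + ∑ i, (c i : ℝ) * θ i = 0 → c₀ = 0 ∧ ∀ i, c i = 0)
    (f₁ : ℂ) (hf₁ : f₁.re ≠ 0 ∧ f₁.im ≠ 0)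
    (f : Fin n → ℂ) (hf : ∀ i, (f i).re ≠ 0 ∧ (f i).im ≠ 0) :
    ∃ ε₀ > 0, ∀ ε : ℝ, 0 < ε → ε < ε₀ → ∃ t : ℕ,
      (∀ u ∈ ({1, -1, Complex.I, -Complex.I} : Set ℂ),
        ε ≤ |Complex.arg (Complex.exp ((t : ℝ) * θ₁ * Complex.I) * f₁ / u)| ∧
        ∀ i, ε ≤ |Complex.arg (Complex.exp ((t : ℝ) * θ i * Complex.I) * f i / u)|) ∧
      (∀ i, SameOrOppositeQuadrant (Complex.exp ((t : ℝ) * θ₁ * Complex.I) * f₁)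
          (Complex.exp ((t : ℝ) * θ i * Complex.I) * f i)) ∧
      (∀ i j, SameOrOppositeQuadrant (Complex.exp ((t : ℝ) * θ i * Complex.I) * f i)
          (Complex.exp ((t : ℝ) * θ j * Complex.I) * f j)) := by
  have hq0 : (q₁ : ℝ) ≠ 0 := by positivity
  have hπ : (π : ℝ) ≠ 0 := Real.pi_ne_zero
  let a : UnitAddTorus (Fin n) := fun i => ((q₁ * θ i / π : ℝ) : UnitAddCircle)
  have ha : ∀ m : Fin n → ℤ, m ≠ 0 → UnitAddTorus.mFourier m a ≠ 1 := by
    intro m hm h1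
    apply hm
    have e : UnitAddTorus.mFourier m a
        = Complex.exp (∑ i, 2 * π * Complex.I * m i * ((q₁ * θ i / π : ℝ) : ℂ)) := by
      rw [Complex.exp_sum]
      simp only [UnitAddTorus.mFourier, ContinuousMap.coe_mk, a]
      refine Finset.prod_congr rfl fun i _ => ?_
      rw [fourier_coe_apply]
      simp
    rw [e, Complex.exp_eq_one_iff] at h1
    obtain ⟨z, hz⟩ := h1
    have hz2 : (∑ i, (m i : ℝ) * (q₁ * θ i / π)) = z := by
      have h2 : (2 * π * Complex.I) * (∑ i, (m i : ℂ) * ((q₁ * θ i / π : ℝ) : ℂ))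
          = (2 * π * Complex.I) * z := by
        rw [Finset.mul_sum, mul_comm _ (z : ℂ), ← hz]
        refine Finset.sum_congr rfl fun i _ => by ring
      have h3 := mul_left_cancel₀ Complex.two_pi_I_ne_zero h2
      exact_mod_cast h3
    have hh := hind (-z) (fun i => q₁ * m i) (by
      push_cast
      rw [← hz2, neg_mul, Finset.sum_mul, neg_add_eq_zero]
      refine Finset.sum_congr rfl fun i _ => ?_
      field_simp)
    funext i
    have := hh.2 i
    have hq' : (q₁ : ℚ) ≠ 0 := by positivity
    simpa [hq'] using this
  let U : Set (UnitAddTorus (Fin n)) :=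
    ⋂ i, {x | 0 < ((AddCircle.toCircle (x i) : ℂ) * f i).re * f₁.re ∧
      0 < ((AddCircle.toCircle (x i) : ℂ) * f i).im * f₁.im}
  have hcont : ∀ i, Continuous fun x : UnitAddTorus (Fin n) =>
      (AddCircle.toCircle (x i) : ℂ) * f i := by
    intro i
    have : Continuous fun x : UnitAddTorus (Fin n) => AddCircle.toCircle (x i) :=
      AddCircle.continuous_toCircle.comp (continuous_apply i)
    fun_prop
  have hU : IsOpen U := by
    refine isOpen_iInter_of_finite fun i => ?_
    refine IsOpen.inter (X := UnitAddTorus (Fin n))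
      (s := {x | 0 < ((AddCircle.toCircle (x i) : ℂ) * f i).re * f₁.re})
      (t := {x | 0 < ((AddCircle.toCircle (x i) : ℂ) * f i).im * f₁.im})
      (isOpen_lt continuous_const ?_) (isOpen_lt continuous_const ?_)
    · exact (Complex.continuous_re.comp (hcont i)).mul continuous_const
    · exact (Complex.continuous_im.comp (hcont i)).mul continuous_const
  have hfi0 : ∀ i, f i ≠ 0 := fun i h => (hf i).1 (by simp [h])
  have hf10 : f₁ ≠ 0 := fun h => hf₁.1 (by simp [h])
  have hne : U.Nonempty := by
    refine ⟨fun i => ((Complex.arg (f₁ / f i) / (2 * π) : ℝ) : UnitAddCircle), ?_⟩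
    refine Set.mem_iInter.2 fun i => ?_
    simp only [Set.mem_ofPred_eq]
    have hr : (0 : ℝ) < ‖f₁ / f i‖ := norm_pos_iff.2 (div_ne_zero hf10 (hfi0 i))
    have e : (AddCircle.toCircle
        ((Complex.arg (f₁ / f i) / (2 * π) : ℝ) : UnitAddCircle) : ℂ) * f i
        = ((‖f₁ / f i‖⁻¹ : ℝ) : ℂ) * f₁ := by
      rw [AddCircle.toCircle_apply_mk, Circle.coe_exp]
      have h1 := Complex.norm_mul_exp_arg_mul_I (f₁ / f i)
      have h2 : 2 * π / 1 * (Complex.arg (f₁ / f i) / (2 * π)) = Complex.arg (f₁ / f i) := by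
        field_simp
      rw [h2]
      have h3 : (((‖f₁ / f i‖ : ℝ)) : ℂ) ≠ 0 := by exact_mod_cast hr.ne'
      rw [Complex.ofReal_inv, eq_inv_mul_iff_mul_eq₀ h3, ← mul_assoc, h1,
        div_mul_cancel₀ _ (hfi0 i)]
    rw [e, Complex.re_ofReal_mul, Complex.im_ofReal_mul, mul_assoc, mul_assoc]
    exact ⟨mul_pos (inv_pos.2 hr) (mul_self_pos.2 hf₁.1),
      mul_pos (inv_pos.2 hr) (mul_self_pos.2 hf₁.2)⟩
  obtain ⟨k, hk⟩ := kronecker_torus a ha U hU hne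
  have hk' := Set.mem_iInter.1 hk
  have e1 : Complex.exp (((2 * q₁ * k : ℕ) : ℝ) * θ₁ * Complex.I) * f₁ = f₁ := by
    have : (((2 * q₁ * k : ℕ) : ℝ) * θ₁ * Complex.I : ℂ)
        = ((p₁ * k : ℕ) : ℂ) * (2 * π * Complex.I) := by
      have hqc : (q₁ : ℂ) ≠ 0 := by exact_mod_cast hq0
      rw [hθ₁]
      push_cast
      field_simp
    rw [this, Complex.exp_nat_mul_two_pi_mul_I, one_mul]
  have e2 : ∀ i, Complex.exp (((2 * q₁ * k : ℕ) : ℝ) * θ i * Complex.I)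
      = (AddCircle.toCircle ((k • a) i) : ℂ) := by
    intro i
    have : (k • a) i = ((k * (q₁ * θ i / π) : ℝ) : UnitAddCircle) := by
      simp only [Pi.smul_apply, a]
      rw [← AddCircle.coe_nsmul, nsmul_eq_mul]
    rw [this, AddCircle.toCircle_apply_mk, Circle.coe_exp]
    congr 1
    have hπc : (π : ℂ) ≠ 0 := by exact_mod_cast hπ
    push_cast
    field_simp
  have hpos : ∀ i, 0 < (Complex.exp (((2 * q₁ * k : ℕ) : ℝ) * θ i * Complex.I) * f i).re * f₁.re ∧
      0 < (Complex.exp (((2 * q₁ * k : ℕ) : ℝ) * θ i * Complex.I) * f i).im * f₁.im := by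
    intro i
    rw [e2 i]
    exact hk' i
  obtain ⟨δ₁, hδ₁, hδ₁'⟩ := exists_cone_gap f₁ hf₁
  have hgap : ∀ i, ∃ δ > 0, ∀ u ∈ ({1, -1, Complex.I, -Complex.I} : Set ℂ),
      δ ≤ |Complex.arg (Complex.exp (((2 * q₁ * k : ℕ) : ℝ) * θ i * Complex.I) * f i / u)| :=
    fun i => exists_cone_gap _
      ⟨left_ne_zero_of_mul (hpos i).1.ne', left_ne_zero_of_mul (hpos i).2.ne'⟩
  choose δ hδ hδ' using hgap
  obtain ⟨δ₂, hδ₂, hδ₂'⟩ := exists_pos_lower δ hδ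
  refine ⟨min δ₁ δ₂, lt_min hδ₁ hδ₂, fun ε _ hε => ⟨2 * q₁ * k, ?_, ?_, ?_⟩⟩
  · intro u hu
    rw [e1]
    refine ⟨(hε.le.trans (min_le_left _ _)).trans (hδ₁' u hu), fun i => ?_⟩
    exact ((hε.le.trans (min_le_right _ _)).trans (hδ₂' i)).trans (hδ' i u hu)
  · intro i
    rw [e1]
    left
    rw [mul_comm f₁.re, mul_comm f₁.im]
    exact hpos i
  · intro i j
    left
    exact ⟨pos_trans (hpos i).1 (hpos j).1, pos_trans (hpos i).2 (hpos j).2⟩
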